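/- arXiv:2306.14661 — 2 statements merged into one kernel-verified Lean document; each statement's English description precedes it below -/
import Mathlib

section
/- The generalized gradient maps (x,Υ) ↦ g_x(x;Υ) = Υ ∘ diag(F Q Diag(β) Q^⊤ F^⊤) − log Υ and (x,Υ) ↦ g_Υ(x;Υ) = x ∘ diag(F Q Diag(β) Q^⊤ F^⊤) − Diag(Υ)^{-1} x are well defined (independent of the choice of spectral decomposition Q with β adjusted accordingly) and continuous on {(x,Υ) : Υ ∈ R^n_{++}, x ∈ dom(f_DDFact;Υ)_+}. (Theorem 3.v) -/
open Matrix
open scoped Matrix BigOperators Classical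

noncomputable section

/-- `(1/(s−ι)) Σ_{ℓ=ι+1}^k λ_ℓ` (eigenvalues indexed from `1`). -/
def avgTail (k s : ℕ) (lam : ℕ → ℝ) (ι : ℕ) : ℝ :=
  (∑ ℓ ∈ Finset.Icc (ι + 1) k, lam ℓ) / ((s : ℝ) - ι)

/-- The defining property of the unique index `ι` of Lemma 1
(with the convention `λ_0 = +∞`, so for `ι = 0` the left inequality is vacuous). -/
def IsIota (k s : ℕ) (lam : ℕ → ℝ) (ι : ℕ) : Prop :=
  ι < s ∧ (1 ≤ ι → avgTail k s lam ι < lam ι) ∧ lam (ι + 1) ≤ avgTail k s lam ι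

/-- The unique index `ι` of Lemma 1 (junk value `0` if no such index exists). -/
def iotaOf (k s : ℕ) (lam : ℕ → ℝ) : ℕ :=
  if h : ∃ ι, IsIota k s lam ι then h.choose else 0

/-- `φ_s(λ) = Σ_{ℓ=1}^ι log λ_ℓ + (s−ι) log((1/(s−ι)) Σ_{ℓ=ι+1}^k λ_ℓ)`. -/
def phiS (k s : ℕ) (lam : ℕ → ℝ) : ℝ :=
  (∑ ℓ ∈ Finset.Icc 1 (iotaOf k s lam), Real.log (lam ℓ)) +
    ((s : ℝ) - iotaOf k s lam) * Real.log (avgTail k s lam (iotaOf k s lam))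

/-- The decreasingly ordered eigenvalues of a symmetric matrix, indexed from `1`
(junk value `0` outside `[1,k]` or if `X` is not Hermitian). -/
def eigsDesc (k : ℕ) (X : Matrix (Fin k) (Fin k) ℝ) : ℕ → ℝ := fun i =>
  if h : X.IsHermitian then
    ((((List.ofFn h.eigenvalues : List ℝ) : Multiset ℝ).sort (· ≤ ·)).reverse).getD (i - 1) 0
  else 0

/-- `Γ_s(X) = φ_s(λ(X))` with `λ(X)` the decreasingly ordered eigenvalues of `X`. -/
def gammaS (k s : ℕ) (X : Matrix (Fin k) (Fin k) ℝ) : ℝ :=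
  phiS k s (eigsDesc k X)

/-- `F_DDFact(x;Υ) = Fᵀ Diag(Υ∘x) F = Σ_i γ_i x_i F_{i·}ᵀ F_{i·}`. -/
def FDD (n k : ℕ) (F : Matrix (Fin n) (Fin k) ℝ) (x Υ : Fin n → ℝ) :
    Matrix (Fin k) (Fin k) ℝ :=
  Fᵀ * Matrix.diagonal (fun i => Υ i * x i) * F

/-- `f_DDFact(x;Υ) = Γ_s(F_DDFact(x;Υ)) − Σ_i x_i log γ_i`. -/
def fDD (n k s : ℕ) (F : Matrix (Fin n) (Fin k) ℝ) (x Υ : Fin n → ℝ) : ℝ :=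
  gammaS k s (FDD n k F x Υ) - ∑ i, x i * Real.log (Υ i)

/-- `β` of Definition 1: `β_i = 1/λ_i` for `i ≤ ι` and
`β_i = (s−ι)/Σ_{ℓ=ι+1}^k λ_ℓ` for `i > ι` (here `β` is indexed by `Fin k`, `j ↔ j+1`). -/
def betaOf (k s : ℕ) (lam : ℕ → ℝ) : Fin k → ℝ := fun j =>
  if (j : ℕ) + 1 ≤ iotaOf k s lam then (lam ((j : ℕ) + 1))⁻¹
  else ((s : ℝ) - iotaOf k s lam) / ∑ ℓ ∈ Finset.Icc (iotaOf k s lam + 1) k, lam ℓ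

/-- `F Q Diag(β) Qᵀ Fᵀ`, whose diagonal appears in the (generalized) gradients. -/
def gMat (n k s : ℕ) (F : Matrix (Fin n) (Fin k) ℝ) (Q : Matrix (Fin k) (Fin k) ℝ)
    (lam : ℕ → ℝ) : Matrix (Fin n) (Fin n) ℝ :=
  F * Q * Matrix.diagonal (betaOf k s lam) * Qᵀ * Fᵀ

/-- `Q, λ` form a spectral decomposition of `F_DDFact(x;Υ)` as in Definition 1:
`Q` orthonormal and `F_DDFact(x;Υ) = Q Diag(λ) Qᵀ` with `λ` decreasing and nonnegative
(indexed from `1`). -/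
def IsSpectralDecomp (n k : ℕ) (F : Matrix (Fin n) (Fin k) ℝ) (x Υ : Fin n → ℝ)
    (Q : Matrix (Fin k) (Fin k) ℝ) (lam : ℕ → ℝ) : Prop :=
  Q * Qᵀ = 1 ∧
  FDD n k F x Υ = Q * Matrix.diagonal (fun j : Fin k => lam ((j : ℕ) + 1)) * Qᵀ ∧
  (∀ i, 0 ≤ lam i) ∧
  (∀ i j, 1 ≤ i → i ≤ j → j ≤ k → lam j ≤ lam i)

/-- Euclidean (2-)norm of a vector in `ℝⁿ`. -/
def enorm2 (n : ℕ) (v : Fin n → ℝ) : ℝ :=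
  Real.sqrt (∑ i, (v i) ^ 2)

section SpectralCalculus

variable {κ : Type*} [Fintype κ] [DecidableEq κ]

/-- Applying a scalar function to the eigenvalues does not depend on the chosen
spectral decomposition. -/
theorem orthogonal_conj_diagonal_comp_eq {Q P : Matrix κ κ ℝ} {d e : κ → ℝ}
    (hQ : Q * Qᵀ = 1) (hP : P * Pᵀ = 1)
    (h : Q * diagonal d * Qᵀ = P * diagonal e * Pᵀ) (f : ℝ → ℝ) :
    Q * diagonal (fun j => f (d j)) * Qᵀ = P * diagonal (fun j => f (e j)) * Pᵀ := by
  have hQ' : Qᵀ * Q = 1 := mul_eq_one_comm.mp hQ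
  have hP' : Pᵀ * P = 1 := mul_eq_one_comm.mp hP
  have h1 : diagonal d * (Qᵀ * P) = (Qᵀ * P) * diagonal e := by
    calc diagonal d * (Qᵀ * P) = (Qᵀ * Q) * diagonal d * (Qᵀ * P) := by rw [hQ', one_mul]
      _ = Qᵀ * (Q * diagonal d * Qᵀ) * P := by simp only [Matrix.mul_assoc]
      _ = Qᵀ * (P * diagonal e * Pᵀ) * P := by rw [h]
      _ = (Qᵀ * P) * diagonal e * (Pᵀ * P) := by simp only [Matrix.mul_assoc]
      _ = (Qᵀ * P) * diagonal e := by rw [hP', mul_one]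
  have h2 : diagonal (fun j => f (d j)) * (Qᵀ * P) =
      (Qᵀ * P) * diagonal (fun j => f (e j)) := by
    ext i j
    have hij := congrFun (congrFun h1 i) j
    rw [diagonal_mul, mul_diagonal] at hij ⊢
    rcases eq_or_ne ((Qᵀ * P) i j) 0 with h0 | h0
    · simp [h0]
    · have : d i = e j := by
        rw [mul_comm] at hij
        exact mul_left_cancel₀ h0 hij
      rw [this, mul_comm]
  calc Q * diagonal (fun j => f (d j)) * Qᵀ
      = Q * diagonal (fun j => f (d j)) * Qᵀ * (P * Pᵀ) := by rw [hP, mul_one]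
    _ = Q * (diagonal (fun j => f (d j)) * (Qᵀ * P)) * Pᵀ := by simp only [Matrix.mul_assoc]
    _ = Q * ((Qᵀ * P) * diagonal (fun j => f (e j))) * Pᵀ := by rw [h2]
    _ = (Q * Qᵀ) * P * diagonal (fun j => f (e j)) * Pᵀ := by simp only [Matrix.mul_assoc]
    _ = P * diagonal (fun j => f (e j)) * Pᵀ := by rw [hQ, one_mul]

theorem trace_orthogonal_conj_diagonal {Q : Matrix κ κ ℝ} (hQ : Q * Qᵀ = 1) (d : κ → ℝ) :
    (Q * diagonal d * Qᵀ).trace = ∑ j, d j := by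
  have hQ' : Qᵀ * Q = 1 := mul_eq_one_comm.mp hQ
  rw [trace_mul_comm, ← Matrix.mul_assoc, hQ', one_mul, trace_diagonal]

theorem sum_comp_eq_of_orthogonal_conj_eq {Q P : Matrix κ κ ℝ} {d e : κ → ℝ}
    (hQ : Q * Qᵀ = 1) (hP : P * Pᵀ = 1)
    (h : Q * diagonal d * Qᵀ = P * diagonal e * Pᵀ) (f : ℝ → ℝ) :
    ∑ j, f (d j) = ∑ j, f (e j) := by
  rw [← trace_orthogonal_conj_diagonal hQ, ← trace_orthogonal_conj_diagonal hP,
    orthogonal_conj_diagonal_comp_eq hQ hP h f]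

theorem rank_orthogonal_conj_diagonal {Q : Matrix κ κ ℝ} (hQ : Q * Qᵀ = 1) (d : κ → ℝ) :
    (Q * diagonal d * Qᵀ).rank = Fintype.card {j // d j ≠ 0} := by
  have hQ' : Qᵀ * Q = 1 := mul_eq_one_comm.mp hQ
  have h1 : IsUnit Q.det := by
    rw [← isUnit_iff_isUnit_det]; exact ⟨⟨Q, Qᵀ, hQ, hQ'⟩, rfl⟩
  have h2 : IsUnit Qᵀ.det := by rwa [det_transpose]
  rw [rank_mul_eq_left_of_isUnit_det _ _ h2, rank_mul_eq_right_of_isUnit_det _ _ h1,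
    rank_diagonal]

theorem abs_apply_le_one_of_mul_transpose_eq_one {Q : Matrix κ κ ℝ} (hQ : Q * Qᵀ = 1)
    (i j : κ) : |Q i j| ≤ 1 := by
  have h := congrFun (congrFun hQ i) i
  rw [mul_apply, one_apply_eq] at h
  simp only [transpose_apply] at h
  rw [← sq_le_one_iff_abs_le_one, sq, ← h]
  exact Finset.single_le_sum (f := fun j => Q i j * Q i j)
    (fun j _ => mul_self_nonneg _) (Finset.mem_univ j)

/-- `τ` is the level at which the eigenvalues `d` are truncated from below. -/
def IsThreshold (s : ℕ) (d : κ → ℝ) (τ : ℝ) : Prop :=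
  0 < τ ∧ ∑ j, min (d j) τ = s * τ ∧ ∑ j, (if τ < d j then (1 : ℝ) else 0) < s

theorem IsThreshold.of_orthogonal_conj_eq {s : ℕ} {Q P : Matrix κ κ ℝ} {d e : κ → ℝ} {τ : ℝ}
    (hQ : Q * Qᵀ = 1) (hP : P * Pᵀ = 1)
    (h : Q * diagonal d * Qᵀ = P * diagonal e * Pᵀ) (hτ : IsThreshold s d τ) :
    IsThreshold s e τ := by
  obtain ⟨h0, h1, h2⟩ := hτ
  refine ⟨h0, ?_, ?_⟩
  · rw [← h1]
    exact (sum_comp_eq_of_orthogonal_conj_eq hQ hP h (fun t => min t τ)).symm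
  · rwa [← sum_comp_eq_of_orthogonal_conj_eq hQ hP h (fun t => if τ < t then (1 : ℝ) else 0)]

end SpectralCalculus

theorem IsThreshold.le {κ : Type*} [Fintype κ] {s : ℕ} {d : κ → ℝ} {τ σ : ℝ} (hd : ∀ j, 0 ≤ d j)
    (hτ : IsThreshold s d τ) (hσ : IsThreshold s d σ) : σ ≤ τ := by
  by_contra! hlt
  obtain ⟨hτ0, hτ1, hτ2⟩ := hτ
  obtain ⟨hσ0, hσ1, hσ2⟩ := hσ
  have hle : ∀ j ∈ Finset.univ, τ * min (d j) σ ≤ σ * min (d j) τ := by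
    intro j _
    rcases le_total (d j) τ with h | h
    · rw [min_eq_left h, min_eq_left (h.trans hlt.le)]
      exact mul_le_mul_of_nonneg_right hlt.le (hd j)
    · rw [min_eq_right h, mul_comm]
      exact mul_le_mul_of_nonneg_right (min_le_right _ _) hτ0.le
  have hsum : ∑ j, τ * min (d j) σ = ∑ j, σ * min (d j) τ := by
    rw [← Finset.mul_sum, ← Finset.mul_sum, hτ1, hσ1]; ring
  have heq := (Finset.sum_eq_sum_iff_of_le hle).mp hsum
  have hmin : ∀ j, min (d j) τ = τ * (if τ < d j then 1 else 0) := by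
    intro j
    have hj := heq j (Finset.mem_univ j)
    split_ifs with h
    · rw [min_eq_right h.le, mul_one]
    · push Not at h
      rw [min_eq_left h, min_eq_left (h.trans hlt.le)] at hj
      rw [min_eq_left h, mul_zero]
      nlinarith [hd j]
  have h3 : (s : ℝ) * τ = τ * ∑ j, (if τ < d j then (1 : ℝ) else 0) := by
    rw [← hτ1, Finset.mul_sum]
    exact Finset.sum_congr rfl fun j _ => hmin j
  nlinarith

theorem IsThreshold.unique {κ : Type*} [Fintype κ] {s : ℕ} {d : κ → ℝ} {τ σ : ℝ} (hd : ∀ j, 0 ≤ d j)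
    (hτ : IsThreshold s d τ) (hσ : IsThreshold s d σ) : τ = σ :=
  le_antisymm (hσ.le hd hτ) (hτ.le hd hσ)

theorem exists_isIota {k s : ℕ} {lam : ℕ → ℝ} (hs : 0 < s) (hsk : s ≤ k)
    (h0 : ∀ i, 0 ≤ lam i) : ∃ ι, IsIota k s lam ι := by
  have hex : ∃ ι, ι < s ∧ lam (ι + 1) ≤ avgTail k s lam ι := by
    refine ⟨s - 1, by omega, ?_⟩
    have : ((s : ℝ) - ((s - 1 : ℕ) : ℝ)) = 1 := by
      rw [Nat.cast_sub (by omega)]; simp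
    rw [avgTail, this, div_one]
    exact Finset.single_le_sum (f := lam) (fun i _ => h0 i) (Finset.mem_Icc.mpr ⟨le_rfl, by omega⟩)
  refine ⟨Nat.find hex, (Nat.find_spec hex).1, fun h1 => ?_, (Nat.find_spec hex).2⟩
  have hlt := (Nat.find_spec hex).1
  have hmin := Nat.find_min hex (m := Nat.find hex - 1) (by omega)
  generalize Nat.find hex = ι at *
  obtain ⟨m, rfl⟩ : ∃ m, ι = m + 1 := ⟨ι - 1, by omega⟩
  simp only [Nat.add_sub_cancel, not_and, not_le] at hmin
  have h := hmin (by omega)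
  have hms : ((m + 1 : ℕ) : ℝ) < s := by exact_mod_cast hlt
  push_cast at hms
  rw [avgTail, div_lt_iff₀ (by linarith),
    ← Finset.add_sum_Ioc_eq_sum_Icc (show m + 1 ≤ k by omega)] at h
  rw [avgTail, div_lt_iff₀ (by push_cast; linarith)]
  have hI : Finset.Icc (m + 1 + 1) k = Finset.Ioc (m + 1) k := by
    ext; simp
  rw [hI]
  push_cast
  linarith

theorem sum_Icc_one_eq_sum_fin (k : ℕ) (g : ℕ → ℝ) :
    ∑ ℓ ∈ Finset.Icc 1 k, g ℓ = ∑ j : Fin k, g ((j : ℕ) + 1) := by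
  rw [Fin.sum_univ_eq_sum_range (fun i => g (i + 1)), Finset.range_eq_Ico,
    Finset.sum_Ico_add' g 0 k 1]
  rfl

/-- The vector `β` inverts the eigenvalues truncated from below at the tail average. -/
theorem exists_truncation_level {k s : ℕ} {lam : ℕ → ℝ} (hs : 0 < s) (hsk : s ≤ k)
    (h0 : ∀ i, 0 ≤ lam i) (hanti : ∀ i j, 1 ≤ i → i ≤ j → j ≤ k → lam j ≤ lam i) :
    ∃ τ, lam s ≤ τ ∧ τ ≤ ∑ j : Fin k, lam ((j : ℕ) + 1) ∧
      ∑ j : Fin k, min (lam ((j : ℕ) + 1)) τ = s * τ ∧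
      betaOf k s lam = fun j : Fin k => (max (lam ((j : ℕ) + 1)) τ)⁻¹ := by
  have hex := exists_isIota (k := k) hs hsk h0
  have hι : IsIota k s lam (iotaOf k s lam) := by
    rw [iotaOf, dif_pos hex]; exact hex.choose_spec
  unfold betaOf
  generalize iotaOf k s lam = ι at *
  obtain ⟨hιs, hl, hr⟩ := hι
  have hpos : (1 : ℝ) ≤ (s : ℝ) - ι := by
    have : ((ι + 1 : ℕ) : ℝ) ≤ s := by exact_mod_cast hιs
    push_cast at this; linarith
  have hlow : ∀ j, ι + 1 ≤ j → j ≤ k → lam j ≤ avgTail k s lam ι := fun j h1 h2 =>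
    (hanti (ι + 1) j (by omega) h1 h2).trans hr
  have hhigh : ∀ j, 1 ≤ j → j ≤ ι → avgTail k s lam ι ≤ lam j := fun j h1 h2 =>
    (hl (by omega)).le.trans (hanti j ι h1 h2 (by omega))
  have hS : ∑ ℓ ∈ Finset.Icc (ι + 1) k, lam ℓ = avgTail k s lam ι * ((s : ℝ) - ι) := by
    rw [avgTail, div_mul_cancel₀ _ (by linarith)]
  have hS0 : 0 ≤ ∑ ℓ ∈ Finset.Icc (ι + 1) k, lam ℓ := Finset.sum_nonneg fun i _ => h0 i
  refine ⟨avgTail k s lam ι, hlow s (by omega) hsk, ?_, ?_, ?_⟩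
  · calc avgTail k s lam ι ≤ ∑ ℓ ∈ Finset.Icc (ι + 1) k, lam ℓ := div_le_self hS0 hpos
      _ ≤ ∑ ℓ ∈ Finset.Icc 1 k, lam ℓ :=
        Finset.sum_le_sum_of_subset_of_nonneg (Finset.Icc_subset_Icc (by omega) le_rfl)
          fun i _ _ => h0 i
      _ = _ := sum_Icc_one_eq_sum_fin k lam
  · rw [← sum_Icc_one_eq_sum_fin k (fun ℓ => min (lam ℓ) (avgTail k s lam ι))]
    have hU : Finset.Icc 1 k = Finset.Icc 1 ι ∪ Finset.Icc (ι + 1) k := by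
      ext; simp only [Finset.mem_union, Finset.mem_Icc]; omega
    have hD : Disjoint (Finset.Icc 1 ι) (Finset.Icc (ι + 1) k) := by
      rw [Finset.disjoint_left]; intro a; simp only [Finset.mem_Icc]; omega
    rw [hU, Finset.sum_union hD]
    have e1 : ∑ ℓ ∈ Finset.Icc 1 ι, min (lam ℓ) (avgTail k s lam ι) =
        ∑ ℓ ∈ Finset.Icc 1 ι, avgTail k s lam ι :=
      Finset.sum_congr rfl fun j hj => min_eq_right
        (hhigh j (Finset.mem_Icc.mp hj).1 (Finset.mem_Icc.mp hj).2)
    have e2 : ∑ ℓ ∈ Finset.Icc (ι + 1) k, min (lam ℓ) (avgTail k s lam ι) =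
        ∑ ℓ ∈ Finset.Icc (ι + 1) k, lam ℓ :=
      Finset.sum_congr rfl fun j hj => min_eq_left
        (hlow j (Finset.mem_Icc.mp hj).1 (Finset.mem_Icc.mp hj).2)
    rw [e1, e2, hS, Finset.sum_const, Nat.card_Icc, nsmul_eq_mul, Nat.add_sub_cancel]
    ring
  · ext j
    have hj := j.2
    split_ifs with h
    · rw [max_eq_left (hhigh _ (by omega) h)]
    · rw [max_eq_right (hlow _ (by omega) (by omega)), avgTail, inv_div]

theorem isThreshold_of_le {k s : ℕ} {d : Fin k → ℝ} {τ : ℝ} (hs : 0 < s) (hsk : s ≤ k)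
    (hd : Antitone d) (hτ0 : 0 < τ) (hτ : d ⟨s - 1, by omega⟩ ≤ τ)
    (hsum : ∑ j, min (d j) τ = s * τ) : IsThreshold s d τ := by
  refine ⟨hτ0, hsum, ?_⟩
  rw [Finset.sum_boole]
  have hsub : (Finset.univ.filter fun j => τ < d j) ⊆ Finset.Iio ⟨s - 1, by omega⟩ := by
    intro j hj
    rw [Finset.mem_filter] at hj
    rw [Finset.mem_Iio]
    by_contra hc
    exact absurd hj.2 (not_lt.mpr ((hd (not_lt.mp hc)).trans hτ))
  have hc := Finset.card_le_card hsub
  rw [Fin.card_Iio] at hc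
  simp only at hc
  exact_mod_cast (by omega : (Finset.univ.filter fun j => τ < d j).card < s)

theorem pos_of_le_rank {k s : ℕ} {Q : Matrix (Fin k) (Fin k) ℝ} {d : Fin k → ℝ} (hs : 0 < s)
    (hsk : s ≤ k) (hQ : Q * Qᵀ = 1) (hd : Antitone d) (hd0 : ∀ j, 0 ≤ d j)
    (hrank : s ≤ (Q * diagonal d * Qᵀ).rank) : 0 < d ⟨s - 1, by omega⟩ := by
  rw [rank_orthogonal_conj_diagonal hQ, Fintype.card_subtype] at hrank
  refine lt_of_le_of_ne (hd0 _) fun h => ?_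
  have hsub : (Finset.univ.filter fun j => d j ≠ 0) ⊆ Finset.Iio ⟨s - 1, by omega⟩ := by
    intro j hj
    rw [Finset.mem_filter] at hj
    rw [Finset.mem_Iio]
    by_contra hc
    exact hj.2 (le_antisymm ((hd (not_lt.mp hc)).trans h.ge) (hd0 j))
  have hc := Finset.card_le_card hsub
  rw [Fin.card_Iio] at hc
  simp only at hc
  omega

open Filter Topology in
theorem Ultrafilter.exists_tendsto_of_eventually_abs_le {α : Type*} (l : Ultrafilter α)
    {u : α → ℝ} {B : ℝ} (h : ∀ᶠ a in (l : Filter α), |u a| ≤ B) :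
    ∃ c, Tendsto u l (𝓝 c) := by
  obtain ⟨c, -, hc⟩ := (isCompact_Icc (a := -B) (b := B)).ultrafilter_le_nhds (l.map u)
    (by
      rw [le_principal_iff, Ultrafilter.coe_map, Filter.mem_map]
      filter_upwards [h] with a ha using abs_le.mp ha)
  exact ⟨c, hc⟩

open Filter Topology in
/-- Continuity of the truncated inverse, along an ultrafilter. -/
theorem tendsto_truncated_inverse {α : Type*} (l : Ultrafilter α) {k s : ℕ} (hs : 0 < s)
    (hsk : s ≤ k) {Q : Matrix (Fin k) (Fin k) ℝ} {d : Fin k → ℝ} {τ : ℝ}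
    {Q' : α → Matrix (Fin k) (Fin k) ℝ} {d' : α → Fin k → ℝ} {τ' : α → ℝ}
    (hQ : Q * Qᵀ = 1) (hd : Antitone d) (hd0 : ∀ j, 0 ≤ d j)
    (hrank : s ≤ (Q * diagonal d * Qᵀ).rank)
    (hτ : d ⟨s - 1, by omega⟩ ≤ τ) (hτs : ∑ j, min (d j) τ = s * τ)
    (hQ' : ∀ a, Q' a * (Q' a)ᵀ = 1) (hd' : ∀ a, Antitone (d' a)) (hd0' : ∀ a j, 0 ≤ d' a j)
    (hτ' : ∀ a, d' a ⟨s - 1, by omega⟩ ≤ τ' a) (hτb' : ∀ a, τ' a ≤ ∑ j, d' a j)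
    (hτs' : ∀ a, ∑ j, min (d' a j) (τ' a) = s * τ' a)
    (hlim : Tendsto (fun a => Q' a * diagonal (d' a) * (Q' a)ᵀ) l
      (𝓝 (Q * diagonal d * Qᵀ))) :
    Tendsto (fun a => Q' a * diagonal (fun j => (max (d' a j) (τ' a))⁻¹) * (Q' a)ᵀ) l
      (𝓝 (Q * diagonal (fun j => (max (d j) τ)⁻¹) * Qᵀ)) := by
  have htr : Tendsto (fun a => ∑ j, d' a j) l (𝓝 (∑ j, d j)) := by
    have := ((Continuous.matrix_trace continuous_id).tendsto _).comp hlim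
    simpa only [Function.comp_def, id, trace_orthogonal_conj_diagonal hQ,
      trace_orthogonal_conj_diagonal (hQ' _)] using this
  have hbd : ∀ᶠ a in (l : Filter α), ∑ j, d' a j ≤ ∑ j, d j + 1 :=
    htr.eventually_le_const (lt_add_one _)
  have hsle : ∀ a j, d' a j ≤ ∑ j, d' a j := fun a j =>
    Finset.single_le_sum (fun i _ => hd0' a i) (Finset.mem_univ j)
  have hcQ : ∀ i j, ∃ c, Tendsto (fun a => Q' a i j) l (𝓝 c) := fun i j =>
    l.exists_tendsto_of_eventually_abs_le (B := 1)
      (Eventually.of_forall fun a => abs_apply_le_one_of_mul_transpose_eq_one (hQ' a) i j)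
  have hcd : ∀ j, ∃ c, Tendsto (fun a => d' a j) l (𝓝 c) := fun j =>
    l.exists_tendsto_of_eventually_abs_le (B := ∑ j, d j + 1) (by
      filter_upwards [hbd] with a ha
      rw [abs_of_nonneg (hd0' a j)]
      exact (hsle a j).trans ha)
  obtain ⟨σ, hσ⟩ : ∃ c, Tendsto τ' l (𝓝 c) :=
    l.exists_tendsto_of_eventually_abs_le (B := ∑ j, d j + 1) (by
      filter_upwards [hbd] with a ha
      rw [abs_of_nonneg ((hd0' a _).trans (hτ' a))]
      exact (hτb' a).trans ha)
  choose P hP using hcQ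
  choose e he using hcd
  have hQP : Tendsto Q' l (𝓝 (Matrix.of P)) :=
    tendsto_pi_nhds.mpr fun i => tendsto_pi_nhds.mpr fun j => hP i j
  generalize Matrix.of P = R at hQP
  have hde : Tendsto d' l (𝓝 e) := tendsto_pi_nhds.mpr he
  have hconj : ∀ {g : α → Fin k → ℝ} {v : Fin k → ℝ}, Tendsto g l (𝓝 v) →
      Tendsto (fun a => Q' a * diagonal (g a) * (Q' a)ᵀ) l (𝓝 (R * diagonal v * Rᵀ)) := by
    intro g v hg
    have hcont : Continuous fun p : Matrix (Fin k) (Fin k) ℝ × (Fin k → ℝ) =>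
        p.1 * diagonal p.2 * p.1ᵀ := by fun_prop
    have := (hcont.tendsto (R, v)).comp (hQP.prodMk_nhds hg)
    simpa only [Function.comp_def] using this
  have hR : R * Rᵀ = 1 := by
    have hcont : Continuous fun M : Matrix (Fin k) (Fin k) ℝ => M * Mᵀ := by fun_prop
    have := (hcont.tendsto R).comp hQP
    simp only [Function.comp_def, hQ'] at this
    exact tendsto_nhds_unique this tendsto_const_nhds
  have hX : Q * diagonal d * Qᵀ = R * diagonal e * Rᵀ := tendsto_nhds_unique hlim (hconj hde)
  have he0 : ∀ j, 0 ≤ e j := fun j => ge_of_tendsto' (he j) fun a => hd0' a j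
  have hea : Antitone e := fun i j hij => le_of_tendsto_of_tendsto' (he j) (he i)
    fun a => hd' a hij
  have heσ : e ⟨s - 1, by omega⟩ ≤ σ := le_of_tendsto_of_tendsto' (he _) hσ hτ'
  have hσs : ∑ j, min (e j) σ = s * σ := by
    refine tendsto_nhds_unique (tendsto_finsetSum _ fun j _ => (he j).min hσ) ?_
    simp only [hτs']
    exact hσ.const_mul _
  have hσ0 : 0 < σ := (pos_of_le_rank hs hsk hR hea he0 (hX ▸ hrank)).trans_le heσ
  have hτ0 : 0 < τ := (pos_of_le_rank hs hsk hQ hd hd0 hrank).trans_le hτ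
  have hστ : σ = τ :=
    ((isThreshold_of_le hs hsk hea hσ0 heσ hσs).of_orthogonal_conj_eq hR hQ hX.symm).unique hd0
      (isThreshold_of_le hs hsk hd hτ0 hτ hτs)
  rw [orthogonal_conj_diagonal_comp_eq hQ hR hX (fun t => (max t τ)⁻¹), ← hστ]
  exact hconj (tendsto_pi_nhds.mpr fun j =>
    ((he j).max hσ).inv₀ (lt_max_of_lt_right hσ0).ne')

open Filter Topology in
theorem tendsto_of_enorm2_sub_lt {α : Type*} {l : Filter α} {n : ℕ} {u : α → Fin n → ℝ}
    {v : Fin n → ℝ} {δ : α → ℝ} (hδ : Tendsto δ l (𝓝 0))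
    (h : ∀ a, enorm2 n (u a - v) < δ a) : Tendsto u l (𝓝 v) := by
  refine tendsto_pi_nhds.mpr fun i => tendsto_iff_dist_tendsto_zero.mpr ?_
  refine squeeze_zero (fun a => dist_nonneg) (fun a => ?_) hδ
  refine le_trans ?_ (h a).le
  rw [Real.dist_eq]
  refine Real.abs_le_sqrt ?_
  exact Finset.single_le_sum (f := fun i => ((u a - v) i) ^ 2) (fun j _ => sq_nonneg _)
    (Finset.mem_univ i)

open Filter Topology in
theorem eventually_enorm2_sub_le {α : Type*} {l : Filter α} {n : ℕ} {u : α → Fin n → ℝ}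
    {v : Fin n → ℝ} (h : Tendsto u l (𝓝 v)) {ε : ℝ} (hε : 0 < ε) :
    ∀ᶠ a in l, enorm2 n (fun i => u a i - v i) ≤ ε := by
  have hcont : Continuous fun w : Fin n → ℝ => enorm2 n (fun i => w i - v i) := by
    unfold enorm2; fun_prop
  have ht := (hcont.tendsto v).comp h
  refine ht.eventually_le_const ?_
  simpa [enorm2] using hε

open Filter Topology in
theorem tendsto_FDD {α : Type*} {l : Filter α} {n k : ℕ} (F : Matrix (Fin n) (Fin k) ℝ)
    {y Ψ : α → Fin n → ℝ} {x Υ : Fin n → ℝ} (hy : Tendsto y l (𝓝 x))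
    (hΨ : Tendsto Ψ l (𝓝 Υ)) :
    Tendsto (fun a => FDD n k F (y a) (Ψ a)) l (𝓝 (FDD n k F x Υ)) := by
  have hcont : Continuous fun p : (Fin n → ℝ) × (Fin n → ℝ) => FDD n k F p.1 p.2 := by
    unfold FDD; fun_prop
  have := (hcont.tendsto (x, Υ)).comp (hy.prodMk_nhds hΨ)
  simpa only [Function.comp_def] using this

/-- Theorem 3.v: the generalized gradient maps
`g_x(x;Υ) = Υ ∘ diag(F Q Diag(β) Qᵀ Fᵀ) − log Υ` and
`g_Υ(x;Υ) = x ∘ diag(F Q Diag(β) Qᵀ Fᵀ) − Diag(Υ)⁻¹ x`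
are well defined (independent of the chosen spectral decomposition `Q`, with `β` adjusted
accordingly) and continuous on `{(x,Υ) : Υ ∈ ℝⁿ₊₊, x ∈ dom(f_DDFact;Υ)₊}`
(stated in ε-δ form, quantifying over spectral decompositions at each point; taking the
nearby point equal to the given one recovers well-definedness). -/
theorem stmt_14 (n k s r : ℕ) (hn : 1 < n) (hs0 : 0 < s) (hsn : s < n)
    (C : Matrix (Fin n) (Fin n) ℝ) (hC : C.PosSemidef)
    (hr : C.rank = r) (hrs : s ≤ r)
    (F : Matrix (Fin n) (Fin k) ℝ) (hF : C = F * Fᵀ) (hk1 : r ≤ k) (hk2 : k ≤ n) :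
    ∀ (x Υ : Fin n → ℝ), (∀ i, 0 < Υ i) → (∀ i, 0 ≤ x i) → s ≤ (FDD n k F x Υ).rank →
    ∀ (Q : Matrix (Fin k) (Fin k) ℝ) (lam : ℕ → ℝ), IsSpectralDecomp n k F x Υ Q lam →
    ∀ ε > (0 : ℝ), ∃ δ > (0 : ℝ), ∀ (y Ψ : Fin n → ℝ),
      (∀ i, 0 < Ψ i) → (∀ i, 0 ≤ y i) → s ≤ (FDD n k F y Ψ).rank →
      enorm2 n (y - x) < δ → enorm2 n (Ψ - Υ) < δ →
      ∀ (Q' : Matrix (Fin k) (Fin k) ℝ) (lam' : ℕ → ℝ),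
        IsSpectralDecomp n k F y Ψ Q' lam' →
        enorm2 n (fun i => (Ψ i * (gMat n k s F Q' lam') i i - Real.log (Ψ i)) -
            (Υ i * (gMat n k s F Q lam) i i - Real.log (Υ i))) ≤ ε ∧
        enorm2 n (fun i => (y i * (gMat n k s F Q' lam') i i - y i / Ψ i) -
            (x i * (gMat n k s F Q lam) i i - x i / Υ i)) ≤ ε := by
  intro x Υ hΥ hx hrank Q lam hspec ε hε
  have hsk : s ≤ k := hrs.trans hk1
  by_contra hcon
  push Not at hcon
  choose y Ψ hΨ0 hy0 hrank' hyx hΨΥ Q' lam' hspec' hbig using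
    fun m : ℕ => hcon (1 / ((m : ℝ) + 1)) (by positivity)
  have hl : (Filter.hyperfilter ℕ : Filter ℕ) ≤ Filter.atTop :=
    Nat.hyperfilter_le_atTop
  generalize Filter.hyperfilter ℕ = l at hl
  have hδ : Filter.Tendsto (fun m : ℕ => 1 / ((m : ℝ) + 1)) l (nhds 0) :=
    tendsto_one_div_add_atTop_nhds_zero_nat.mono_left hl
  have hy := tendsto_of_enorm2_sub_lt hδ hyx
  have hΨ := tendsto_of_enorm2_sub_lt hδ hΨΥ
  obtain ⟨hQ, hX, h0, hanti⟩ := hspec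
  have hQ' := fun m => (hspec' m).1
  have hX' := fun m => (hspec' m).2.1
  have h0' := fun m => (hspec' m).2.2.1
  have hanti' := fun m => (hspec' m).2.2.2
  obtain ⟨τ, hτ, -, hτs, hβ⟩ := exists_truncation_level hs0 hsk h0 hanti
  choose τ' hτ' hτb' hτs' hβ' using
    fun m => exists_truncation_level hs0 hsk (h0' m) (hanti' m)
  have hmono : ∀ {mu : ℕ → ℝ}, (∀ i j, 1 ≤ i → i ≤ j → j ≤ k → mu j ≤ mu i) →
      Antitone fun j : Fin k => mu ((j : ℕ) + 1) := fun h i j hij =>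
    h _ _ (by omega) (by have : (i : ℕ) ≤ j := hij; omega) j.2
  have hs1 : s - 1 + 1 = s := by omega
  have hlim := tendsto_FDD F hy hΨ
  simp only [hX, hX'] at hlim
  rw [hX] at hrank
  have hG := tendsto_truncated_inverse l hs0 hsk hQ (hmono hanti) (fun j => h0 _) hrank
    (by simpa only [hs1] using hτ) hτs hQ' (fun m => hmono (hanti' m)) (fun m j => h0' m _)
    (fun m => by simpa only [hs1] using hτ' m) hτb' hτs' hlim
  have hg : ∀ i, Filter.Tendsto (fun m => gMat n k s F (Q' m) (lam' m) i i) l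
      (nhds (gMat n k s F Q lam i i)) := by
    intro i
    have hcont : Continuous fun M : Matrix (Fin k) (Fin k) ℝ => (F * M * Fᵀ) i i := by
      fun_prop
    have := (hcont.tendsto _).comp hG
    simpa only [Function.comp_def, gMat, hβ, hβ', Matrix.mul_assoc] using this
  have hyi := fun i => tendsto_pi_nhds.mp hy i
  have hΨi := fun i => tendsto_pi_nhds.mp hΨ i
  have h1 := eventually_enorm2_sub_le (l := (l : Filter ℕ))
    (u := fun m i => Ψ m i * gMat n k s F (Q' m) (lam' m) i i - Real.log (Ψ m i))
    (v := fun i => Υ i * gMat n k s F Q lam i i - Real.log (Υ i))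
    (tendsto_pi_nhds.mpr fun i =>
      ((hΨi i).mul (hg i)).sub ((hΨi i).log (hΥ i).ne')) hε
  have h2 := eventually_enorm2_sub_le (l := (l : Filter ℕ))
    (u := fun m i => y m i * gMat n k s F (Q' m) (lam' m) i i - y m i / Ψ m i)
    (v := fun i => x i * gMat n k s F Q lam i i - x i / Υ i)
    (tendsto_pi_nhds.mpr fun i =>
      ((hyi i).mul (hg i)).sub ((hyi i).div (hΨi i) (hΥ i).ne')) hε
  obtain ⟨m, hm1, hm2⟩ := (h1.and h2).exists
  exact (hbig m hm1).not_ge hm2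

end
end

section
/- Let H be an n×n real symmetric positive semidefinite matrix. Then the Hadamard product (H+I)^{-1} ∘ (I − (H+I)^{-1}) is positive semidefinite. Consequently, for Υ ∈ R^n_{++} and 0 ≤ x < e with F_linx(x;Υ) = Diag(Υ)CDiag(x)CDiag(Υ) + Diag(e−x), the matrix Diag(e−x)·Diag(diag(F_linx(x;Υ)^{-1})) − Diag(e−x)·(F_linx(x;Υ)^{-1} ∘ F_linx(x;Υ)^{-1})·Diag(e−x), which equals one half of the Hessian of f_linx(x;Υ) with respect to log Υ, is positive semidefinite. (Key claim in the proof of Theorem 2.iii, Case 1) -/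
open Matrix
open scoped Matrix BigOperators

noncomputable section

/-- `F_linx(x;Υ) = Diag(Υ) C Diag(x) C Diag(Υ) + Diag(e−x)`. -/
def FLinx (n : ℕ) (C : Matrix (Fin n) (Fin n) ℝ) (x Υ : Fin n → ℝ) :
    Matrix (Fin n) (Fin n) ℝ :=
  Matrix.diagonal Υ * C * Matrix.diagonal x * C * Matrix.diagonal Υ +
    Matrix.diagonal (fun i => 1 - x i)

theorem Matrix.PosSemidef.one_sub_inv_add_one {ι : Type*} [Fintype ι] [DecidableEq ι]
    {H : Matrix ι ι ℝ} (hH : H.PosSemidef) : (1 - (H + 1)⁻¹).PosSemidef := by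
  have hP : (H + 1).PosDef := PosDef.posSemidef_add hH PosDef.one
  have hu : IsUnit (H + 1).det := (Matrix.isUnit_iff_isUnit_det _).mp hP.isUnit
  have hHH : (H + H * H).PosSemidef := by
    refine hH.add ?_
    simpa only [hH.isHermitian.eq] using posSemidef_self_mul_conjTranspose H
  have key := hHH.mul_mul_conjTranspose_same ((H + 1)⁻¹)
  rw [hP.isHermitian.inv.eq] at key
  convert key using 1
  have h1 : H + H * H = (H + 1) * H := by noncomm_ring
  rw [h1, ← Matrix.mul_assoc, Matrix.nonsing_inv_mul _ hu, Matrix.one_mul]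
  calc 1 - (H + 1)⁻¹ = (H + 1) * (H + 1)⁻¹ - (H + 1)⁻¹ := by rw [Matrix.mul_nonsing_inv _ hu]
    _ = H * (H + 1)⁻¹ := by noncomm_ring

theorem Matrix.PosSemidef.hadamard_inv_add_one {ι : Type*} [Fintype ι] [DecidableEq ι]
    {H : Matrix ι ι ℝ} (hH : H.PosSemidef) :
    ((H + 1)⁻¹ ⊙ (1 - (H + 1)⁻¹)).PosSemidef :=
  (PosDef.posSemidef_add hH PosDef.one).inv.posSemidef.hadamard hH.one_sub_inv_add_one

theorem Matrix.PosSemidef.diagonal_mul_sub_hadamard_inv {ι : Type*} [Fintype ι] [DecidableEq ι]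
    {A : Matrix ι ι ℝ} (hA : A.PosSemidef) {d : ι → ℝ} (hd : ∀ i, 0 < d i) :
    (diagonal d * diagonal ((A + diagonal d)⁻¹.diag) -
      diagonal d * ((A + diagonal d)⁻¹ ⊙ (A + diagonal d)⁻¹) * diagonal d).PosSemidef := by
  set s : ι → ℝ := fun i => √(d i)
  have hs0 (i) : s i ≠ 0 := (Real.sqrt_pos.mpr (hd i)).ne'
  have hss (i) : s i * s i = d i := Real.mul_self_sqrt (hd i).le
  set T : Matrix ι ι ℝ := diagonal fun i => (s i)⁻¹ with hT
  have hTd : T * diagonal d * T = 1 := by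
    rw [hT, diagonal_mul_diagonal, diagonal_mul_diagonal, ← diagonal_one]
    congr 1
    ext i
    rw [← hss i]
    field_simp [hs0 i]
  have hTinv : T⁻¹ = diagonal s := by
    apply Matrix.inv_eq_right_inv
    rw [hT, diagonal_mul_diagonal, ← diagonal_one]
    congr 1
    ext i
    exact inv_mul_cancel₀ (hs0 i)
  have hH : (T * A * T).PosSemidef := by
    simpa [hT, diagonal_conjTranspose] using hA.mul_mul_conjTranspose_same T
  have hK : (T * A * T + 1)⁻¹ = diagonal s * (A + diagonal d)⁻¹ * diagonal s := by
    rw [← hTd, ← Matrix.add_mul, ← Matrix.mul_add, Matrix.mul_inv_rev, Matrix.mul_inv_rev, hTinv,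
      Matrix.mul_assoc]
  have key := hH.hadamard_inv_add_one
  rw [hK] at key
  convert key using 1
  ext i j
  rw [diagonal_mul_diagonal]
  simp only [sub_apply, hadamard_apply, diagonal_mul, mul_diagonal, ← hss]
  rcases eq_or_ne i j with rfl | h
  · simp only [diagonal_apply_eq, diag_apply, one_apply_eq]
    ring
  · simp only [diagonal_apply_ne _ h, one_apply_ne h]
    ring

/-- Key claim in the proof of Theorem 2.iii (Case 1): for `H ⪰ 0`, the Hadamard product
`(H+I)⁻¹ ∘ (I − (H+I)⁻¹)` is positive semidefinite; consequently, for `Υ > 0` and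
`0 ≤ x < e`, the matrix
`Diag(e−x)·Diag(diag(F_linx(x;Υ)⁻¹)) − Diag(e−x)·(F_linx(x;Υ)⁻¹ ∘ F_linx(x;Υ)⁻¹)·Diag(e−x)`
(one half of the Hessian of `f_linx(x;Υ)` in `log Υ`) is positive semidefinite. -/
theorem stmt_18 (n : ℕ) (hn : 1 < n)
    (C : Matrix (Fin n) (Fin n) ℝ) (hC : C.PosSemidef) :
    (∀ H : Matrix (Fin n) (Fin n) ℝ, H.PosSemidef →
      ((H + 1)⁻¹ ⊙ (1 - (H + 1)⁻¹)).PosSemidef) ∧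
    (∀ (Υ x : Fin n → ℝ), (∀ i, 0 < Υ i) → (∀ i, 0 ≤ x i) → (∀ i, x i < 1) →
      (Matrix.diagonal (fun i => 1 - x i) *
          Matrix.diagonal ((FLinx n C x Υ)⁻¹.diag) -
        Matrix.diagonal (fun i => 1 - x i) *
          ((FLinx n C x Υ)⁻¹ ⊙ (FLinx n C x Υ)⁻¹) *
          Matrix.diagonal (fun i => 1 - x i)).PosSemidef) := by
  refine ⟨fun H hH => hH.hadamard_inv_add_one, fun Υ x _ hx0 hx1 => ?_⟩
  refine PosSemidef.diagonal_mul_sub_hadamard_inv ?_ fun i => sub_pos.mpr (hx1 i)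
  have h := (PosSemidef.diagonal hx0).mul_mul_conjTranspose_same (diagonal Υ * C)
  simpa only [conjTranspose_mul, hC.isHermitian.eq, diagonal_conjTranspose, star_trivial,
    Matrix.mul_assoc] using h

end
end
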